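/- If τ = iY where Y is a real symmetric positive definite g×g matrix, then for every u ∈ ℝ^g the value θ(u) = Σ_{n ∈ ℤ^g} exp(−π nᵗYn) exp(2πi nᵗu) is a real number and θ(u) > 0. -/

import Mathlib

open Complex BigOperators

/-- The value of the Riemann theta function with purely imaginary period matrix
`τ = iY` at a real point `u ∈ ℝ^g`:
`θ(u) = Σ_{n ∈ ℤ^g} exp(−π nᵗYn) exp(2πi nᵗu)`. -/
noncomputable def thetaIY {g : ℕ} (Y : Matrix (Fin g) (Fin g) ℝ)
    (u : Fin g → ℝ) : ℂ :=
  ∑' n : Fin g → ℤ,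
    Complex.exp (-(Real.pi : ℂ) * ((∑ i, ∑ j, (n i : ℝ) * Y i j * (n j : ℝ) : ℝ) : ℂ)) *
      Complex.exp (2 * (Real.pi : ℂ) * Complex.I * ((∑ i, (n i : ℝ) * u i : ℝ) : ℂ))

/-- The real quadratic form attached to a square matrix. -/
def quadForm {g : ℕ} (Y : Matrix (Fin g) (Fin g) ℝ) (x : Fin g → ℝ) : ℝ :=
  ∑ i, ∑ j, x i * Y i j * x j

/-- The Schur complement of the top left entry of a symmetric matrix. -/
noncomputable def schurHead {g : ℕ} (Y : Matrix (Fin (g + 1)) (Fin (g + 1)) ℝ) :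
    Matrix (Fin g) (Fin g) ℝ :=
  fun i j => Y i.succ j.succ - Y 0 i.succ * Y 0 j.succ / Y 0 0

lemma quadForm_cons {g : ℕ} {Y : Matrix (Fin (g + 1)) (Fin (g + 1)) ℝ} (hY : Y.IsSymm)
    (h0 : Y 0 0 ≠ 0) (t : ℝ) (x : Fin g → ℝ) :
    quadForm Y (Fin.cons t x) =
      Y 0 0 * (t + (∑ j, x j * Y 0 j.succ) / Y 0 0) ^ 2 + quadForm (schurHead Y) x := by
  have hs : ∀ i : Fin g, Y i.succ 0 = Y 0 i.succ := fun i => hY.apply 0 i.succ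
  have hB : ∑ i, ∑ j, x i * (Y 0 i.succ * Y 0 j.succ / Y 0 0) * x j =
      (∑ j, x j * Y 0 j.succ) ^ 2 / Y 0 0 := by
    rw [sq, Finset.sum_mul_sum, Finset.sum_div]
    refine Finset.sum_congr rfl fun i _ => ?_
    rw [Finset.sum_div]
    refine Finset.sum_congr rfl fun j _ => ?_
    ring
  have hS : quadForm (schurHead Y) x = ∑ i, ∑ j, x i * Y i.succ j.succ * x j -
      (∑ j, x j * Y 0 j.succ) ^ 2 / Y 0 0 := by
    rw [← hB]
    simp only [quadForm, schurHead, mul_sub, sub_mul, Finset.sum_sub_distrib]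
  have h1 : ∑ j, t * Y 0 (Fin.succ j) * x j = t * ∑ j, x j * Y 0 j.succ := by
    rw [Finset.mul_sum]
    exact Finset.sum_congr rfl fun j _ => by ring
  have h2 : ∑ j, x j * Y 0 (Fin.succ j) * t = t * ∑ j, x j * Y 0 j.succ := by
    rw [Finset.mul_sum]
    exact Finset.sum_congr rfl fun j _ => by ring
  rw [hS]
  simp only [quadForm, Fin.sum_univ_succ, Fin.cons_zero, Fin.cons_succ, hs,
    Finset.sum_add_distrib, h1, h2]
  field_simp
  ring

lemma schurHead_isSymm {g : ℕ} {Y : Matrix (Fin (g + 1)) (Fin (g + 1)) ℝ} (hY : Y.IsSymm) :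
    (schurHead Y).IsSymm := by
  ext i j
  simp only [schurHead, Matrix.transpose_apply, hY.apply i.succ j.succ]
  ring

lemma quadForm_schurHead_pos {g : ℕ} {Y : Matrix (Fin (g + 1)) (Fin (g + 1)) ℝ} (hY : Y.IsSymm)
    (h0 : Y 0 0 ≠ 0) (hpos : ∀ x, x ≠ 0 → 0 < quadForm Y x) (x : Fin g → ℝ) (hx : x ≠ 0) :
    0 < quadForm (schurHead Y) x := by
  have h := hpos (Fin.cons (-((∑ j, x j * Y 0 j.succ) / Y 0 0)) x) (by
    intro h
    apply hx
    ext i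
    simpa using congrFun h i.succ)
  rw [quadForm_cons hY h0] at h
  simpa using h

lemma head_pos_of_quadForm_pos {g : ℕ} {Y : Matrix (Fin (g + 1)) (Fin (g + 1)) ℝ}
    (hpos : ∀ x, x ≠ 0 → 0 < quadForm Y x) : 0 < Y 0 0 := by
  have h := hpos (Fin.cons 1 0) (by
    intro h
    simpa using congrFun h 0)
  simpa [quadForm, Fin.sum_univ_succ] using h

lemma summable_gaussian_shift {t : ℝ} (ht : 0 < t) (a : ℝ) :
    Summable fun n : ℤ => Real.exp (-Real.pi * (n + a) ^ 2 * t) :=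
  (HurwitzZeta.hasSum_int_evenKernel a ht).summable

lemma cosKernel_le {t : ℝ} (ht : 0 < t) (a : ℝ) :
    HurwitzZeta.cosKernel a t ≤ ∑' n : ℤ, Real.exp (-Real.pi * n ^ 2 * t) := by
  have h := HurwitzZeta.hasSum_int_cosKernel a ht
  have hn : ∀ n : ℤ, ‖cexp (2 * Real.pi * I * a * n) * (Real.exp (-Real.pi * n ^ 2 * t) : ℂ)‖ =
      Real.exp (-Real.pi * n ^ 2 * t) := by
    intro n
    rw [norm_mul, Complex.norm_real, Real.norm_of_nonneg (Real.exp_pos _).le,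
      show 2 * Real.pi * I * a * n = ((2 * Real.pi * a * n : ℝ) : ℂ) * I by push_cast; ring,
      Complex.norm_exp_ofReal_mul_I, one_mul]
  have hs : Summable fun n : ℤ => Real.exp (-Real.pi * n ^ 2 * t) := by
    simpa using summable_gaussian_shift ht 0
  have := norm_tsum_le_tsum_norm (f := fun n : ℤ =>
    cexp (2 * Real.pi * I * a * n) * (Real.exp (-Real.pi * n ^ 2 * t) : ℂ)) (by simpa only [hn])
  rw [h.tsum_eq, Complex.norm_real] at this
  simp only [hn] at this
  exact (Real.le_norm_self _).trans this

lemma exists_tsum_gaussian_shift_le {t : ℝ} (ht : 0 < t) :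
    ∃ C, ∀ a : ℝ, ∑' n : ℤ, Real.exp (-Real.pi * (n + a) ^ 2 * t) ≤ C := by
  refine ⟨1 / t ^ (1 / 2 : ℝ) * ∑' n : ℤ, Real.exp (-Real.pi * n ^ 2 * (1 / t)), fun a => ?_⟩
  rw [(HurwitzZeta.hasSum_int_evenKernel a ht).tsum_eq,
    HurwitzZeta.evenKernel_functional_equation]
  exact mul_le_mul_of_nonneg_left (cosKernel_le (by positivity) a) (by positivity)

/-- Splitting an integer vector of length `g + 1` into its tail and its head. -/
def tailHeadEquiv (g : ℕ) : (Fin g → ℤ) × ℤ ≃ (Fin (g + 1) → ℤ) :=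
  (Equiv.prodComm _ _).trans (Fin.consEquiv fun _ => ℤ)

lemma tailHeadEquiv_cast {g : ℕ} (m : Fin g → ℤ) (k : ℤ) :
    (fun i => (tailHeadEquiv g (m, k) i : ℝ)) = Fin.cons (k : ℝ) fun i => (m i : ℝ) := by
  ext i
  refine Fin.cases ?_ (fun i => ?_) i <;> simp [tailHeadEquiv, Fin.consEquiv]

lemma summable_exp_neg_quadForm {g : ℕ} (Y : Matrix (Fin g) (Fin g) ℝ) (hY : Y.IsSymm)
    (hpos : ∀ x, x ≠ 0 → 0 < quadForm Y x) :
    Summable fun n : Fin g → ℤ => Real.exp (-Real.pi * quadForm Y fun i => n i) := by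
  induction g with
  | zero => exact Summable.of_finite
  | succ g ih =>
    have hc := head_pos_of_quadForm_pos hpos
    have ihS := ih (schurHead Y) (schurHead_isSymm hY)
      (quadForm_schurHead_pos hY hc.ne' hpos)
    obtain ⟨C, hC⟩ := exists_tsum_gaussian_shift_le hc
    rw [← (tailHeadEquiv g).summable_iff]
    have hterm : ∀ (m : Fin g → ℤ) (k : ℤ),
        Real.exp (-Real.pi * quadForm Y fun i => tailHeadEquiv g (m, k) i) =
          Real.exp (-Real.pi * (k + (∑ j, m j * Y 0 j.succ) / Y 0 0) ^ 2 * Y 0 0) *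
            Real.exp (-Real.pi * quadForm (schurHead Y) fun i => m i) := by
      intro m k
      rw [tailHeadEquiv_cast, quadForm_cons hY hc.ne', ← Real.exp_add]
      congr 1
      ring
    refine (summable_prod_of_nonneg fun _ => (Real.exp_pos _).le).2 ⟨fun m => ?_, ?_⟩
    · simp only [hterm]
      exact (summable_gaussian_shift hc _).mul_right _
    · simp only [hterm, tsum_mul_right]
      exact (ihS.mul_left C).of_nonneg_of_le
        (fun m => mul_nonneg (tsum_nonneg fun _ => (Real.exp_pos _).le) (Real.exp_pos _).le)
        fun m => mul_le_mul_of_nonneg_right (hC _) (Real.exp_pos _).le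

/-- The general term of the series defining `thetaIY`. -/
noncomputable def thetaIYTerm {g : ℕ} (Y : Matrix (Fin g) (Fin g) ℝ) (u x : Fin g → ℝ) : ℂ :=
  cexp (-(Real.pi : ℂ) * (quadForm Y x : ℂ)) *
    cexp (2 * (Real.pi : ℂ) * I * ((∑ i, x i * u i : ℝ) : ℂ))

lemma thetaIY_eq_tsum {g : ℕ} (Y : Matrix (Fin g) (Fin g) ℝ) (u : Fin g → ℝ) :
    thetaIY Y u = ∑' n : Fin g → ℤ, thetaIYTerm Y u fun i => n i := rfl

lemma norm_thetaIYTerm {g : ℕ} (Y : Matrix (Fin g) (Fin g) ℝ) (u x : Fin g → ℝ) :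
    ‖thetaIYTerm Y u x‖ = Real.exp (-Real.pi * quadForm Y x) := by
  rw [thetaIYTerm, norm_mul, mul_right_comm, ← ofReal_ofNat, ← ofReal_mul, ← ofReal_mul,
    Complex.norm_exp_ofReal_mul_I, mul_one, ← ofReal_neg, ← ofReal_mul, ← ofReal_exp,
    Complex.norm_real, Real.norm_of_nonneg (Real.exp_pos _).le]

lemma summable_thetaIYTerm {g : ℕ} {Y : Matrix (Fin g) (Fin g) ℝ} (hY : Y.IsSymm)
    (hpos : ∀ x, x ≠ 0 → 0 < quadForm Y x) (u : Fin g → ℝ) :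
    Summable fun n : Fin g → ℤ => thetaIYTerm Y u fun i => n i :=
  .of_norm (by simpa only [norm_thetaIYTerm] using summable_exp_neg_quadForm Y hY hpos)

/-- Poisson summation in the first coordinate. -/
lemma tsum_thetaIYTerm_cons {g : ℕ} {Y : Matrix (Fin (g + 1)) (Fin (g + 1)) ℝ} (hY : Y.IsSymm)
    (hc : 0 < Y 0 0) (u : Fin (g + 1) → ℝ) (x : Fin g → ℝ) :
    ∑' k : ℤ, thetaIYTerm Y u (Fin.cons (k : ℝ) x) =
      ((1 / Y 0 0 ^ (1 / 2 : ℝ) : ℝ) : ℂ) * ∑' l : ℤ,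
        (Real.exp (-Real.pi * (l + -u 0) ^ 2 * (1 / Y 0 0)) : ℂ) *
          thetaIYTerm (schurHead Y) (fun i => u i.succ + (l - u 0) * Y 0 i.succ / Y 0 0) x := by
  have hc' : (Y 0 0 : ℂ) ≠ 0 := ofReal_ne_zero.2 hc.ne'
  set B : ℝ := ∑ j, x j * Y 0 j.succ with hB
  set D : ℂ := cexp (-(Real.pi : ℂ) * (B ^ 2 / Y 0 0 + quadForm (schurHead Y) x) +
    2 * Real.pi * I * ((∑ i, x i * u i.succ : ℝ) : ℂ)) with hD
  have hL : ∀ k : ℤ, thetaIYTerm Y u (Fin.cons (k : ℝ) x) =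
      cexp (-Real.pi * (Y 0 0 : ℂ) * k ^ 2 + 2 * Real.pi * (-B + I * u 0) * k) * D := by
    intro k
    rw [thetaIYTerm, quadForm_cons hY hc.ne', hD, ← Complex.exp_add, ← Complex.exp_add,
      Fin.sum_univ_succ, ← hB]
    simp only [Fin.cons_zero, Fin.cons_succ]
    congr 1
    push_cast
    field_simp
    ring
  have hsum : ∀ l : ℤ, ∑ i, x i * (u i.succ + (l - u 0) * Y 0 i.succ / Y 0 0) =
      ∑ i, x i * u i.succ + (l - u 0) * B / Y 0 0 := by
    intro l
    rw [hB, Finset.mul_sum, Finset.sum_div, ← Finset.sum_add_distrib]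
    exact Finset.sum_congr rfl fun i _ => by ring
  have hR : ∀ l : ℤ, cexp (-Real.pi / (Y 0 0 : ℂ) * (l + I * (-B + I * u 0)) ^ 2) * D =
      (Real.exp (-Real.pi * (l + -u 0) ^ 2 * (1 / Y 0 0)) : ℂ) *
          thetaIYTerm (schurHead Y) (fun i => u i.succ + (l - u 0) * Y 0 i.succ / Y 0 0) x := by
    intro l
    rw [thetaIYTerm, hsum, hD, ofReal_exp, ← Complex.exp_add, ← Complex.exp_add,
      ← Complex.exp_add, show (l : ℂ) + I * (-B + I * u 0) = l - u 0 - I * B by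
        linear_combination (u 0 : ℂ) * I_sq]
    congr 1
    push_cast
    field_simp
    linear_combination (-(B : ℂ) ^ 2) * I_sq
  simp only [hL, ← hR, tsum_mul_right]
  rw [Complex.tsum_exp_neg_quadratic (by simpa using hc), ofReal_div, ofReal_cpow hc.le]
  push_cast
  ring

lemma thetaIY_succ {g : ℕ} {Y : Matrix (Fin (g + 1)) (Fin (g + 1)) ℝ} (hY : Y.IsSymm)
    (hpos : ∀ x, x ≠ 0 → 0 < quadForm Y x) (u : Fin (g + 1) → ℝ) :
    thetaIY Y u = ((1 / Y 0 0 ^ (1 / 2 : ℝ) : ℝ) : ℂ) * ∑' l : ℤ,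
      (Real.exp (-Real.pi * (l + -u 0) ^ 2 * (1 / Y 0 0)) : ℂ) *
        thetaIY (schurHead Y) (fun i => u i.succ + (l - u 0) * Y 0 i.succ / Y 0 0) := by
  have hc := head_pos_of_quadForm_pos hpos
  have hS := summable_exp_neg_quadForm (schurHead Y) (schurHead_isSymm hY)
    (quadForm_schurHead_pos hY hc.ne' hpos)
  have hsum := (tailHeadEquiv g).summable_iff.2 (summable_thetaIYTerm hY hpos u)
  rw [thetaIY_eq_tsum, ← (tailHeadEquiv g).tsum_eq]
  refine (hsum.tsum_prod).trans ?_
  simp only [Function.comp_apply, tailHeadEquiv_cast, tsum_thetaIYTerm_cons hY hc,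
    tsum_mul_left]
  congr 1
  simp only [thetaIY_eq_tsum, ← tsum_mul_left]
  refine Summable.tsum_comm (f := fun (l : ℤ) (m : Fin g → ℤ) =>
    (Real.exp (-Real.pi * (l + -u 0) ^ 2 * (1 / Y 0 0)) : ℂ) *
      thetaIYTerm (schurHead Y) (fun i => u i.succ + (l - u 0) * Y 0 i.succ / Y 0 0)
        fun i => m i) (.of_norm ?_)
  refine ((summable_gaussian_shift (one_div_pos.2 hc) (-u 0)).mul_of_nonneg hS
    (fun _ => (Real.exp_pos _).le) (fun _ => (Real.exp_pos _).le)).congr fun p => ?_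
  rw [Function.uncurry_apply_pair, norm_mul, norm_thetaIYTerm, Complex.norm_real,
    Real.norm_of_nonneg (Real.exp_pos _).le]

lemma norm_thetaIY_le {g : ℕ} {Y : Matrix (Fin g) (Fin g) ℝ} (hY : Y.IsSymm)
    (hpos : ∀ x, x ≠ 0 → 0 < quadForm Y x) (u : Fin g → ℝ) :
    ‖thetaIY Y u‖ ≤ ∑' n : Fin g → ℤ, Real.exp (-Real.pi * quadForm Y fun i => n i) := by
  have h := norm_tsum_le_tsum_norm (summable_thetaIYTerm hY hpos u).norm
  simpa only [norm_thetaIYTerm, thetaIY_eq_tsum] using h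

lemma exists_pos_thetaIY_eq {g : ℕ} (Y : Matrix (Fin g) (Fin g) ℝ) (hY : Y.IsSymm)
    (hpos : ∀ x, x ≠ 0 → 0 < quadForm Y x) (u : Fin g → ℝ) :
    ∃ r : ℝ, 0 < r ∧ thetaIY Y u = r := by
  induction g with
  | zero => exact ⟨1, one_pos, by simp [thetaIY]⟩
  | succ g ih =>
    have hc := head_pos_of_quadForm_pos hpos
    have hSsymm := schurHead_isSymm hY
    have hSpos := quadForm_schurHead_pos hY hc.ne' hpos
    choose r hr hθ using ih (schurHead Y) hSsymm hSpos
    set w : ℤ → Fin g → ℝ := fun l i => u i.succ + (l - u 0) * Y 0 i.succ / Y 0 0 with hw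
    refine ⟨1 / Y 0 0 ^ (1 / 2 : ℝ) * ∑' l : ℤ,
      Real.exp (-Real.pi * (l + -u 0) ^ 2 * (1 / Y 0 0)) * r (w l),
      mul_pos (by positivity) ?_, ?_⟩
    · refine Summable.tsum_pos ?_ (fun l => (mul_pos (Real.exp_pos _) (hr _)).le) 0
        (mul_pos (Real.exp_pos _) (hr _))
      refine ((summable_gaussian_shift (one_div_pos.2 hc) (-u 0)).mul_right
        (∑' n : Fin g → ℤ, Real.exp (-Real.pi * quadForm (schurHead Y) fun i => n i))
        ).of_nonneg_of_le (fun l => (mul_pos (Real.exp_pos _) (hr _)).le) fun l => ?_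
      refine mul_le_mul_of_nonneg_left ?_ (Real.exp_pos _).le
      have h := norm_thetaIY_le hSsymm hSpos (w l)
      rwa [hθ, Complex.norm_real, Real.norm_of_nonneg (hr _).le] at h
    · rw [thetaIY_succ hY hpos, ofReal_mul, ofReal_tsum]
      simp only [hθ, ofReal_mul, hw]

/-- If `τ = iY` with `Y` real symmetric positive definite, then for every `u ∈ ℝ^g`
the value `θ(u) = Σ_{n ∈ ℤ^g} exp(−π nᵗYn) exp(2πi nᵗu)` is real and positive. -/
theorem thetaIY_real_and_pos
    (g : ℕ) (hg : 1 ≤ g) (Y : Matrix (Fin g) (Fin g) ℝ)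
    (hY : Y.IsSymm) (hYpos : Y.PosDef) (u : Fin g → ℝ) :
    (thetaIY Y u).im = 0 ∧ 0 < (thetaIY Y u).re := by
  obtain ⟨r, hr, h⟩ := exists_pos_thetaIY_eq Y hY (fun x hx => by
    have := hYpos.dotProduct_mulVec_pos hx
    simpa [quadForm, dotProduct, Matrix.mulVec, Finset.mul_sum, mul_assoc] using this) u
  rw [h]
  exact ⟨ofReal_im r, by simpa using hr⟩
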